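/- arXiv:2505.20750 — 8 statements merged into one kernel-verified Lean document; each statement's English description precedes it below -/
import Mathlib

section
/- Let A ∈ ℝ^{n×n}, B ∈ ℝ^{n×m}, F ∈ ℝ^{r×n} with rank F = r, and suppose rank [FA; F] = rank F. Let F⁻ ∈ ℝ^{n×r} be any right inverse of F (i.e., F F⁻ = I_r). Then for every K ∈ ℝ^{m×r}, F(A + BKF) = (F A F⁻ + F B K) F; in particular, if F(A + BKF) = NF with N ∈ ℝ^{r×r}, then N = F A F⁻ + F B K, so the poles of the closed-loop target-output subsystem are the eigenvalues of F A F⁻ + F B K. -/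
open Matrix

theorem stmt_1 (n m r : ℕ)
    (A : Matrix (Fin n) (Fin n) ℝ) (B : Matrix (Fin n) (Fin m) ℝ)
    (F : Matrix (Fin r) (Fin n) ℝ) (hF : F.rank = r)
    (hrk : (Matrix.fromRows (F * A) F).rank = F.rank)
    (Finv : Matrix (Fin n) (Fin r) ℝ) (hFinv : F * Finv = 1) :
    ∀ K : Matrix (Fin m) (Fin r) ℝ,
      F * (A + B * K * F) = (F * A * Finv + F * B * K) * F ∧
      ∀ N : Matrix (Fin r) (Fin r) ℝ,
        F * (A + B * K * F) = N * F → N = F * A * Finv + F * B * K := by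
  have hle : Submodule.span ℝ (Set.range F.row) ≤
      Submodule.span ℝ (Set.range (Matrix.fromRows (F * A) F).row) := by
    apply Submodule.span_mono
    rintro _ ⟨i, rfl⟩
    exact ⟨Sum.inr i, rfl⟩
  have heq := Submodule.eq_of_le_of_finrank_eq hle (by
    rw [← Matrix.rank_eq_finrank_span_row, ← Matrix.rank_eq_finrank_span_row, hrk])
  have hex : ∀ i, ∃ v : Fin r → ℝ, v ᵥ* F = (F * A) i := by
    intro i
    have h : (F * A) i ∈ Submodule.span ℝ (Set.range F.row) := by
      rw [heq]
      exact Submodule.subset_span ⟨Sum.inl i, rfl⟩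
    rw [← _root_.range_vecMulLinear] at h
    obtain ⟨v, hv⟩ := h
    exact ⟨v, hv⟩
  choose M hM using hex
  have hMF : F * A = (Matrix.of M) * F := by
    ext i j
    rw [← hM i]
    rfl
  have key : F * A * Finv * F = F * A := by
    rw [hMF, Matrix.mul_assoc (Matrix.of M) F Finv, hFinv, Matrix.mul_one]
  intro K
  constructor
  · rw [Matrix.mul_add, Matrix.add_mul, key]
    simp only [Matrix.mul_assoc]
  · intro N hN
    have h := congrArg (· * Finv) hN
    simp only [Matrix.mul_add, Matrix.add_mul, Matrix.mul_assoc, hFinv, Matrix.mul_one] at h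
    simp only [Matrix.mul_assoc]
    exact h.symm
end

section
/- Under Assumption 1, the data matrices satisfy rank [U_p; Z_p] = rank F + m and rank [U_p; Z_p; Z_f] = rank [F; FA] + m. -/
open Matrix

theorem rank_aux {n m T : ℕ} {k : Type} [Fintype k]
    (G : Matrix k (Fin n) ℝ) (H : Matrix k (Fin m) ℝ)
    (Up : Matrix (Fin m) (Fin T) ℝ) (Xp : Matrix (Fin n) (Fin T) ℝ)
    (hPE : (Matrix.fromRows Up Xp).rank = m + n) :
    (Matrix.fromRows Up (G * Xp + H * Up)).rank = G.rank + m := by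
  have hsurj : LinearMap.range (Matrix.fromRows Up Xp).mulVecLin = ⊤ := by
    apply Submodule.eq_top_of_finrank_eq
    rw [Matrix.rank] at hPE
    rw [hPE]
    simp
  set M : Matrix (Fin m ⊕ k) (Fin m ⊕ Fin n) ℝ := Matrix.fromBlocks 1 0 H G with hM
  have hW : Matrix.fromRows Up (G * Xp + H * Up) = M * Matrix.fromRows Up Xp := by
    rw [hM, Matrix.fromBlocks_mul_fromRows]
    simp [add_comm]
  have h1 : (Matrix.fromRows Up (G * Xp + H * Up)).rank = M.rank := by
    rw [hW, Matrix.rank, Matrix.rank, Matrix.mulVecLin_mul, LinearMap.range_comp, hsurj,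
      Submodule.map_top]
  have h2 := LinearMap.finrank_range_add_finrank_ker M.mulVecLin
  have h3 := LinearMap.finrank_range_add_finrank_ker G.mulVecLin
  let J : (Fin n → ℝ) →ₗ[ℝ] (Fin m ⊕ Fin n → ℝ) :=
    { toFun := fun x => Sum.elim 0 x
      map_add' := by intro x y; ext i; cases i <;> simp
      map_smul' := by intro c y; ext i; cases i <;> simp }
  have hJ : Function.Injective J := by
    intro x y h
    ext i
    exact congrFun h (Sum.inr i)
  have hker : LinearMap.ker M.mulVecLin = (LinearMap.ker G.mulVecLin).map J := by
    ext v
    simp only [LinearMap.mem_ker, Submodule.mem_map, Matrix.mulVecLin_apply, hM,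
      Matrix.fromBlocks_mulVec]
    constructor
    · intro h
      have ha : v ∘ Sum.inl = 0 := by
        ext i
        simpa using congrFun h (Sum.inl i)
      refine ⟨v ∘ Sum.inr, ?_, ?_⟩
      · ext i
        simpa [ha] using congrFun h (Sum.inr i)
      · ext i
        rcases i with i | i
        · exact (congrFun ha i).symm
        · rfl
    · rintro ⟨x, hx, rfl⟩
      have e1 : J x ∘ Sum.inl = 0 := rfl
      have e2 : J x ∘ Sum.inr = x := rfl
      rw [e1, e2]
      ext i
      rcases i with i | i <;> simp [hx]
  have h4 : Module.finrank ℝ (LinearMap.ker M.mulVecLin)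
      = Module.finrank ℝ (LinearMap.ker G.mulVecLin) := by
    rw [hker]
    exact (Submodule.equivMapOfInjective J hJ _).finrank_eq.symm
  simp only [Module.finrank_fintype_fun_eq_card, Fintype.card_sum, Fintype.card_fin] at h2 h3
  rw [h1, Matrix.rank, Matrix.rank]
  omega

theorem stmt_6 (n m r T : ℕ)
    (A : Matrix (Fin n) (Fin n) ℝ) (B : Matrix (Fin n) (Fin m) ℝ)
    (F : Matrix (Fin r) (Fin n) ℝ)
    (Up : Matrix (Fin m) (Fin T) ℝ)
    (Xp Xf : Matrix (Fin n) (Fin T) ℝ)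
    (Zp Zf : Matrix (Fin r) (Fin T) ℝ)
    (hXf : Xf = A * Xp + B * Up)
    (hZp : Zp = F * Xp) (hZf : Zf = F * Xf)
    (hPE : (Matrix.fromRows Up Xp).rank = m + n) :
    (Matrix.fromRows Up Zp).rank = F.rank + m ∧
    (Matrix.fromRows Up (Matrix.fromRows Zp Zf)).rank =
      (Matrix.fromRows F (F * A)).rank + m := by
  constructor
  · have h := rank_aux F 0 Up Xp hPE
    rw [Matrix.zero_mul, add_zero, ← hZp] at h
    exact h
  · rw [← rank_aux (Matrix.fromRows F (F * A)) (Matrix.fromRows 0 (F * B)) Up Xp hPE]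
    congr 2
    rw [Matrix.fromRows_mul, Matrix.fromRows_mul]
    subst hZf hXf hZp
    ext i j
    rcases i with i | i <;> simp [Matrix.mul_add, Matrix.mul_assoc]
end

section
/- Under Assumption 1, suppose T₁ ∈ ℝ^{r×m} and T₂ ∈ ℝ^{r×r} satisfy Z_f = T₁ U_p + T₂ Z_p. Then for every K ∈ ℝ^{m×r}, F(A + BKF) = (T₁ K + T₂) F; i.e., under the feedback u(t) = K F x(t), the target output z(t) = F x(t) obeys z(t+1) = (T₁ K + T₂) z(t). -/
open Matrix

theorem stmt_13 (n m r T : ℕ)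
    (A : Matrix (Fin n) (Fin n) ℝ) (B : Matrix (Fin n) (Fin m) ℝ)
    (F : Matrix (Fin r) (Fin n) ℝ)
    (Up : Matrix (Fin m) (Fin T) ℝ)
    (Xp Xf : Matrix (Fin n) (Fin T) ℝ)
    (Zp Zf : Matrix (Fin r) (Fin T) ℝ)
    (hXf : Xf = A * Xp + B * Up)
    (hZp : Zp = F * Xp) (hZf : Zf = F * Xf)
    (hPE : (Matrix.fromRows Up Xp).rank = m + n)
    (T₁ : Matrix (Fin r) (Fin m) ℝ) (T₂ : Matrix (Fin r) (Fin r) ℝ)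
    (hT : Zf = T₁ * Up + T₂ * Zp) :
    ∀ K : Matrix (Fin m) (Fin r) ℝ,
      F * (A + B * K * F) = (T₁ * K + T₂) * F ∧
      ∀ x : ℕ → Fin n → ℝ,
        (∀ t : ℕ, x (t + 1) = (A + B * K * F).mulVec (x t)) →
        ∀ t : ℕ, F.mulVec (x (t + 1)) = (T₁ * K + T₂).mulVec (F.mulVec (x t)) := by
  have hsurj : Function.Surjective (Matrix.fromRows Up Xp).mulVecLin := by
    rw [← LinearMap.range_eq_top]
    apply Submodule.eq_top_of_finrank_eq
    have h : Module.finrank ℝ (LinearMap.range (Matrix.fromRows Up Xp).mulVecLin) = m + n := hPE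
    rw [h]
    simp
  have hmul : Matrix.fromCols (F * B) (F * A) * Matrix.fromRows Up Xp
      = Matrix.fromCols T₁ (T₂ * F) * Matrix.fromRows Up Xp := by
    rw [Matrix.fromCols_mul_fromRows, Matrix.fromCols_mul_fromRows, Matrix.mul_assoc T₂, ← hZp,
      ← hT, hZf, hXf, Matrix.mul_add, Matrix.mul_assoc, Matrix.mul_assoc, add_comm]
  have heq : Matrix.fromCols (F * B) (F * A) = Matrix.fromCols T₁ (T₂ * F) := by
    apply Matrix.ext_of_mulVec_single
    intro i
    obtain ⟨v, hv⟩ := hsurj (Pi.single i 1)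
    rw [Matrix.mulVecLin_apply] at hv
    rw [← hv, Matrix.mulVec_mulVec, Matrix.mulVec_mulVec, hmul]
  obtain ⟨hB, hA⟩ := Matrix.fromCols_inj heq
  intro K
  have key : F * (A + B * K * F) = (T₁ * K + T₂) * F := by
    rw [Matrix.mul_add, Matrix.add_mul, hA, ← hB, add_comm]
    simp only [Matrix.mul_assoc]
  refine ⟨key, fun x hx t => ?_⟩
  rw [hx t, Matrix.mulVec_mulVec, Matrix.mulVec_mulVec, key]
end

section
/- Under Assumption 1 with rank F = r, suppose rank [U_p; Z_p; Z_f] = rank [U_p; Z_p] and for every λ ∈ ℂ, rank (λ Z_p − Z_f) = rank Z_p. Let T₁ ∈ ℝ^{r×m}, T₂ ∈ ℝ^{r×r} be matrices with Z_f = T₁ U_p + T₂ Z_p. Then for every monic polynomial p ∈ ℝ[X] of degree r there exists K ∈ ℝ^{m×r} such that the characteristic polynomial of T₁ K + T₂ equals p and F(A + BKF) = (T₁ K + T₂) F; i.e., the data-driven feedback u(t) = K F x(t) is a target output controller with arbitrarily assignable poles. -/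
open Matrix Polynomial

section helpers

variable {k V U : Type*} [Field k] [AddCommGroup V] [Module k V] [FiniteDimensional k V]
  [AddCommGroup U] [Module k U]

lemma coeff_iter_divX (p : k[X]) (i j : ℕ) : (divX^[i] p).coeff j = p.coeff (j + i) := by
  induction i generalizing j with
  | zero => simp
  | succ i ih => rw [Function.iterate_succ_apply', coeff_divX, ih]; congr 1; omega

lemma iter_divX_monic (p : k[X]) (hp : p.Monic) : divX^[p.natDegree] p = 1 := by
  ext j
  rw [coeff_iter_divX, coeff_one]
  rcases Nat.eq_zero_or_pos j with rfl | hj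
  · simpa using hp.leadingCoeff
  · rw [if_neg (by omega), coeff_eq_zero_of_natDegree_lt (by omega)]

lemma horner_step (M : Module.End k V) (p : k[X]) (i : ℕ) (b : V) :
    aeval M (divX^[i] p) b = M (aeval M (divX^[i+1] p) b) + p.coeff i • b := by
  have h := X_mul_divX_add (divX^[i] p)
  rw [coeff_iter_divX, zero_add] at h
  conv_lhs => rw [← h]
  rw [Function.iterate_succ_apply']
  simp [aeval_C, Module.algebraMap_end_apply]

/-- A cyclic vector `b` of `M` with `p(M) b = 0` determines the characteristic polynomial. -/
lemma charpoly_of_cyclic (M : Module.End k V) (b : V)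
    (hc : ∀ W : Submodule k V, b ∈ W → (∀ x ∈ W, M x ∈ W) → W = ⊤)
    (p : k[X]) (hp : p.Monic) (hd : p.natDegree = Module.finrank k V)
    (h0 : aeval M p b = 0) : M.charpoly = p := by
  have hcomm : ∀ (s : k[X]) (x : V), aeval M s (M x) = M (aeval M s x) := by
    intro s x
    have : aeval M s * M = M * aeval M s := by
      have := congrArg (aeval M) (mul_comm s X)
      simpa using this
    exact LinearMap.congr_fun this x
  have hpM : aeval M p = 0 := by
    have := hc (LinearMap.ker (aeval M p)) h0 (by
      intro x hx
      rw [LinearMap.mem_ker] at hx ⊢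
      rw [hcomm, hx, map_zero])
    exact LinearMap.ker_eq_top.1 this
  have hint : IsIntegral k M := Algebra.IsIntegral.isIntegral M
  set q := minpoly k M with hq
  have hqm : q.Monic := minpoly.monic hint
  have hle : Module.finrank k V ≤ q.natDegree := by
    let f : (Fin q.natDegree → k) →ₗ[k] V :=
      ((LinearMap.applyₗ b).comp (aeval M).toLinearMap).comp
        ((degreeLT k q.natDegree).subtype.comp (degreeLTEquiv k q.natDegree).symm.toLinearMap)
    have hmem : ∀ s : k[X], aeval M s b ∈ LinearMap.range f := by
      intro s
      rw [← minpoly.aeval_modByMonic_minpoly]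
      refine ⟨degreeLTEquiv k q.natDegree ⟨s %ₘ q, ?_⟩, ?_⟩
      · rw [mem_degreeLT, ← degree_eq_natDegree hqm.ne_zero]
        exact degree_modByMonic_lt _ hqm
      · simp [f, hq]
    have htop : LinearMap.range f = ⊤ := by
      apply hc
      · simpa using hmem 1
      · rintro x ⟨c, rfl⟩
        have := hmem (X * ((degreeLTEquiv k q.natDegree).symm c : k[X]))
        simpa [f] using this
    have := LinearMap.finrank_range_le f
    rw [htop, finrank_top] at this
    simpa using this
  have e1 : p = q := eq_of_monic_of_dvd_of_natDegree_le hqm hp (minpoly.dvd k M hpM)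
    (by omega)
  have e2 : M.charpoly = q := eq_of_monic_of_dvd_of_natDegree_le hqm M.charpoly_monic
    (LinearMap.minpoly_dvd_charpoly M) (by rw [LinearMap.charpoly_natDegree]; omega)
  rw [e1, e2]

/-- Single-input pole placement. -/
lemma single_input (A : Module.End k V) (b : V)
    (hc : ∀ W : Submodule k V, b ∈ W → (∀ x ∈ W, A x ∈ W) → W = ⊤)
    (p : k[X]) (hp : p.Monic) (hd : p.natDegree = Module.finrank k V) :
    ∃ φ : V →ₗ[k] k, (A + φ.smulRight b).charpoly = p := by
  set q := A.charpoly with hq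
  have hqm : q.Monic := A.charpoly_monic
  have hqd : q.natDegree = Module.finrank k V := A.charpoly_natDegree
  set n := Module.finrank k V with hn
  let e : ℕ → V := fun i => aeval A (divX^[i] q) b
  have he0 : e 0 = 0 := by simp [e, hq, LinearMap.aeval_self_charpoly]
  have hen : e n = b := by
    have := iter_divX_monic q hqm
    rw [hqd] at this
    simp [e, this]
  have hstep : ∀ i, e i = A (e (i+1)) + q.coeff i • b := fun i => horner_step A q i b
  let v : Fin n → V := fun i => e (i + 1)
  have hmem : ∀ i, i ≤ n → e i ∈ Submodule.span k (Set.range v) := by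
    intro i hi
    cases i with
    | zero => rw [he0]; exact zero_mem _
    | succ i => exact Submodule.subset_span ⟨⟨i, by omega⟩, rfl⟩
  have hb : b ∈ Submodule.span k (Set.range v) := by
    have := hmem n le_rfl
    rwa [hen] at this
  have hspan : Submodule.span k (Set.range v) = ⊤ := by
    apply hc _ hb
    intro x hx
    have : Submodule.span k (Set.range v) ≤ (Submodule.span k (Set.range v)).comap A := by
      rw [Submodule.span_le]
      rintro _ ⟨i, rfl⟩
      have h1 : A (v i) = e i - q.coeff i • b := by rw [hstep i]; simp [v]
      show A (v i) ∈ Submodule.span k (Set.range v)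
      rw [h1]
      exact Submodule.sub_mem _ (hmem _ (by omega)) (Submodule.smul_mem _ _ hb)
    exact this hx
  have hli : LinearIndependent k v :=
    linearIndependent_of_top_le_span_of_card_eq_finrank hspan.ge (by simp [hn])
  let bs := Module.Basis.mk hli hspan.ge
  let φ : V →ₗ[k] k := bs.constr k (fun i : Fin n => q.coeff i - p.coeff i)
  have hφ : ∀ i, i < n → φ (e (i+1)) = q.coeff i - p.coeff i := by
    intro i hi
    have := bs.constr_basis k (fun i : Fin n => q.coeff i - p.coeff i) ⟨i, hi⟩
    rw [Module.Basis.mk_apply] at this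
    exact this
  refine ⟨φ, charpoly_of_cyclic _ b ?_ p hp hd ?_⟩
  · intro W hbW hW
    apply hc W hbW
    intro x hx
    have h1 := W.sub_mem (hW x hx) (W.smul_mem (φ x) hbW)
    simpa using h1
  · have key : ∀ j, j ≤ n → aeval (A + φ.smulRight b) (divX^[n - j] p) b = e (n - j) := by
      intro j
      induction j with
      | zero =>
        intro _
        have := iter_divX_monic p hp
        rw [hd] at this
        simp [this, hen]
      | succ j ih =>
        intro hj
        have hs : n - j = n - (j+1) + 1 := by omega
        have ih' := ih (by omega)
        rw [hs] at ih'
        rw [horner_step, ih', hstep (n - (j+1))]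
        simp only [LinearMap.add_apply, LinearMap.smulRight_apply]
        rw [hφ _ (by omega), sub_smul]
        abel
    have := key n le_rfl
    simpa [he0] using this

/-- Heymann's lemma. -/
lemma heymann (A : Module.End k V) (B : U →ₗ[k] V)
    (hc : ∀ W : Submodule k V, LinearMap.range B ≤ W → (∀ x ∈ W, A x ∈ W) → W = ⊤) :
    ∃ (K : V →ₗ[k] U) (w : U), ∀ W : Submodule k V, B w ∈ W →
      (∀ x ∈ W, (A + B ∘ₗ K) x ∈ W) → W = ⊤ := by
  have main : ∀ j, j ≤ Module.finrank k V → ∃ x : ℕ → V, x 0 = 0 ∧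
      (∀ i, i < j → x (i+1) - A (x i) ∈ LinearMap.range B) ∧
      LinearIndependent k (fun i : Fin j => x (i+1)) := by
    intro j
    induction j with
    | zero => exact fun _ => ⟨fun _ => 0, rfl, by simp, linearIndependent_empty_type⟩
    | succ j ih =>
      intro hj
      obtain ⟨x, hx0, hx, hli⟩ := ih (by omega)
      set L := Submodule.span k (Set.range (fun i : Fin j => x (i+1))) with hL
      have hxL : ∀ i, i ≤ j → x i ∈ L := by
        intro i hi
        cases i with
        | zero => rw [hx0]; exact zero_mem _
        | succ i => exact Submodule.subset_span ⟨⟨i, by omega⟩, rfl⟩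
      have hex : ∃ u : U, A (x j) + B u ∉ L := by
        by_contra hno
        push Not at hno
        have hA : A (x j) ∈ L := by simpa using hno 0
        have hB : LinearMap.range B ≤ L := by
          rintro _ ⟨u, rfl⟩
          have := L.sub_mem (hno u) hA
          simpa using this
        have hAx : ∀ i, i ≤ j → A (x i) ∈ L := by
          intro i hi
          rcases hi.lt_or_eq with h | rfl
          · have := L.sub_mem (hxL (i+1) h) (hB (hx i h))
            simpa using this
          · exact hA
        have htop := hc L hB (by
          intro y hy
          have : L ≤ L.comap A := by
            conv_lhs => rw [hL]
            rw [Submodule.span_le]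
            rintro _ ⟨i, rfl⟩
            exact hAx _ (by omega)
          exact this hy)
        have := finrank_range_le_card (R := k) (fun i : Fin j => x (i+1))
        rw [Set.finrank, ← hL, htop, finrank_top] at this
        simp at this
        omega
      obtain ⟨u, hu⟩ := hex
      refine ⟨fun i => if i = j + 1 then A (x j) + B u else x i, by simp [hx0], ?_, ?_⟩
      · intro i hi
        rcases (Nat.lt_succ_iff.1 hi).lt_or_eq with h | rfl
        · have h1 : i ≠ j := by omega
          have h2 : i ≠ j + 1 := by omega
          simpa [h1, h2] using hx i h
        · simp
      · rw [linearIndependent_finSucc']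
        have : (Fin.init fun i : Fin (j+1) =>
            if (i:ℕ) + 1 = j + 1 then A (x j) + B u else x (i+1)) =
            fun i : Fin j => x (i+1) := by
          funext i
          have := i.2.ne
          simp [Fin.init, this]
        rw [this]
        exact ⟨hli, by simpa using hu⟩
  obtain ⟨x, hx0, hx, hli⟩ := main _ le_rfl
  set n := Module.finrank k V with hn
  have hspan := hli.span_eq_top_of_card_eq_finrank' (by simp [hn])
  rcases Nat.eq_zero_or_pos n with h0 | hpos
  · refine ⟨0, 0, fun W _ _ => ?_⟩
    have : Subsingleton V := Module.finrank_zero_iff.1 h0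
    exact Subsingleton.elim _ _
  choose u hu using hx
  let bs := Module.Basis.mk hli hspan.ge
  let K : V →ₗ[k] U := bs.constr k
    (fun i : Fin n => if h : (i:ℕ) + 1 < n then u (i+1) h else 0)
  have hK : ∀ i (h : i + 1 < n), K (x (i+1)) = u (i+1) h := by
    intro i hi
    have := bs.constr_basis k
      (fun i : Fin n => if h : (i:ℕ) + 1 < n then u (i+1) h else 0) ⟨i, by omega⟩
    rw [Module.Basis.mk_apply] at this
    rw [dif_pos hi] at this
    exact this
  refine ⟨K, u 0 hpos, ?_⟩
  intro W hb hW
  have hmem : ∀ i, i < n → x (i+1) ∈ W := by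
    intro i
    induction i with
    | zero =>
      intro _
      have := hu 0 hpos
      rw [hx0, map_zero, sub_zero] at this
      rwa [← this]
    | succ i ih =>
      intro hi
      have h1 := hW _ (ih (by omega))
      simpa [hK i hi, hu] using h1
  rw [eq_top_iff, ← hspan, Submodule.span_le]
  rintro _ ⟨i, rfl⟩
  exact hmem i i.2

lemma pole_placement (A : Module.End k V) (B : U →ₗ[k] V)
    (hc : ∀ W : Submodule k V, LinearMap.range B ≤ W → (∀ x ∈ W, A x ∈ W) → W = ⊤)
    (p : k[X]) (hp : p.Monic) (hd : p.natDegree = Module.finrank k V) :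
    ∃ K : V →ₗ[k] U, (A + B ∘ₗ K).charpoly = p := by
  obtain ⟨K, w, h⟩ := heymann A B hc
  obtain ⟨φ, hφ⟩ := single_input _ _ h p hp hd
  refine ⟨K + φ.smulRight w, ?_⟩
  rw [← hφ]
  congr 1
  ext x
  simp [add_assoc]

end helpers

lemma exists_right_inv {k : Type*} [Field k] {m n : Type*} [Fintype m] [Fintype n]
    [DecidableEq m] [DecidableEq n]
    (M : Matrix m n k) (h : M.rank = Fintype.card m) : ∃ R : Matrix n m k, M * R = 1 := by
  rw [← Matrix.mulVec_surjective_iff_exists_right_inverse]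
  have : LinearMap.range M.mulVecLin = ⊤ := by
    apply Submodule.eq_top_of_finrank_eq
    rw [Module.finrank_pi]
    exact h
  exact LinearMap.range_eq_top.1 this

/-- The complex Hautus test implies the real controllability condition. -/
lemma controllable_of_pbh {r m : ℕ} (T₁ : Matrix (Fin r) (Fin m) ℝ) (T₂ : Matrix (Fin r) (Fin r) ℝ)
    (h : ∀ (l : ℂ) (v : Fin r → ℂ), v ᵥ* T₂.map Complex.ofReal = l • v →
      v ᵥ* T₁.map Complex.ofReal = 0 → v = 0)
    (W : Submodule ℝ (Fin r → ℝ)) (hB : LinearMap.range T₁.mulVecLin ≤ W)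
    (hA : ∀ x ∈ W, T₂.mulVecLin x ∈ W) : W = ⊤ := by
  by_contra hne
  obtain ⟨f, hf0, hf⟩ := Submodule.exists_le_ker_of_lt_top W (lt_top_iff_ne_top.2 hne)
  let a : Fin r → ℝ := fun i => f (Pi.single i 1)
  have hfa : ∀ x, f x = a ⬝ᵥ x := by
    intro x
    rw [LinearMap.pi_apply_eq_sum_univ f x]
    refine Finset.sum_congr rfl fun i _ => ?_
    have : (fun j => if i = j then (1:ℝ) else 0) = Pi.single i 1 := by
      ext j
      simp [Pi.single_apply, eq_comm]
    rw [this, smul_eq_mul, mul_comm]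
  have hpow : ∀ (j : ℕ) (x), x ∈ W → (T₂ ^ j) *ᵥ x ∈ W := by
    intro j
    induction j with
    | zero => simp
    | succ j ih =>
      intro x hx
      rw [pow_succ, ← Matrix.mulVec_mulVec]
      exact ih _ (hA x hx)
  have hreal : ∀ j : ℕ, a ᵥ* (T₂ ^ j * T₁) = 0 := by
    intro j
    apply dotProduct_eq_zero
    intro y
    rw [← Matrix.dotProduct_mulVec, ← Matrix.mulVec_mulVec, ← hfa]
    exact hf (hpow j _ (hB ⟨y, rfl⟩))
  let N : Submodule ℂ (Fin r → ℂ) :=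
    ⨅ j : ℕ, LinearMap.ker ((T₂ ^ j * T₁).map Complex.ofReal).vecMulLinear
  have hN : ∀ v, v ∈ N ↔ ∀ j : ℕ, v ᵥ* (T₂ ^ j * T₁).map Complex.ofReal = 0 := by
    intro v
    simp [N, Submodule.mem_iInf]
  have hmap : ∀ {p q s : ℕ} (X : Matrix (Fin p) (Fin q) ℝ) (Y : Matrix (Fin q) (Fin s) ℝ),
      (X * Y).map Complex.ofReal = X.map Complex.ofReal * Y.map Complex.ofReal := by
    intro p q s X Y
    exact Matrix.map_mul (f := Complex.ofRealHom)
  have hinv : ∀ v ∈ N, (T₂.map Complex.ofReal).vecMulLinear v ∈ N := by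
    intro v hv
    rw [hN] at hv ⊢
    intro j
    have := hv (j+1)
    rw [pow_succ', Matrix.mul_assoc, hmap] at this
    simpa [Matrix.vecMul_vecMul] using this
  let ac : Fin r → ℂ := fun i => (a i : ℂ)
  have hac : ac ∈ N := by
    rw [hN]
    intro j
    ext i
    have := congrFun (hreal j) i
    simp only [Matrix.vecMul, dotProduct, Pi.zero_apply] at this ⊢
    have := congrArg Complex.ofReal this
    simpa [ac] using this
  have hac0 : ac ≠ 0 := by
    intro h0
    apply hf0
    ext i
    have := congrFun h0 i
    simpa [ac, a] using this
  have : Nontrivial N := ⟨⟨⟨ac, hac⟩, 0, fun h => hac0 (congrArg Subtype.val h)⟩⟩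
  obtain ⟨l, hl⟩ := Module.End.exists_eigenvalue
    (((T₂.map Complex.ofReal).vecMulLinear).restrict hinv)
  obtain ⟨v, hv⟩ := hl.exists_hasEigenvector
  have hv1 := congrArg Subtype.val hv.apply_eq_smul
  apply hv.2
  apply Subtype.ext
  refine h l v.1 (by simpa using hv1) ?_
  simpa using (hN _).1 v.2 0

theorem stmt_14 (n m r T : ℕ)
    (A : Matrix (Fin n) (Fin n) ℝ) (B : Matrix (Fin n) (Fin m) ℝ)
    (F : Matrix (Fin r) (Fin n) ℝ) (hF : F.rank = r)
    (Up : Matrix (Fin m) (Fin T) ℝ)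
    (Xp Xf : Matrix (Fin n) (Fin T) ℝ)
    (Zp Zf : Matrix (Fin r) (Fin T) ℝ)
    (hXf : Xf = A * Xp + B * Up)
    (hZp : Zp = F * Xp) (hZf : Zf = F * Xf)
    (hPE : (Matrix.fromRows Up Xp).rank = m + n)
    (hrk : (Matrix.fromRows Up (Matrix.fromRows Zp Zf)).rank =
      (Matrix.fromRows Up Zp).rank)
    (hpbh : ∀ l : ℂ, (l • Zp.map Complex.ofReal - Zf.map Complex.ofReal).rank =
      (Zp.map Complex.ofReal).rank)
    (T₁ : Matrix (Fin r) (Fin m) ℝ) (T₂ : Matrix (Fin r) (Fin r) ℝ)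
    (hT : Zf = T₁ * Up + T₂ * Zp) :
    ∀ p : Polynomial ℝ, p.Monic → p.natDegree = r →
      ∃ K : Matrix (Fin m) (Fin r) ℝ,
        (T₁ * K + T₂).charpoly = p ∧
        F * (A + B * K * F) = (T₁ * K + T₂) * F := by
  classical
  intro p hp hpd
  obtain ⟨G, hG⟩ := exists_right_inv F (by simpa using hF)
  obtain ⟨R, hR⟩ := exists_right_inv (Matrix.fromRows Up Xp) (by simpa using hPE)
  have hFAB : F * B = T₁ ∧ F * A = T₂ * F := by
    have h1 : Matrix.fromCols (F * B) (F * A) * Matrix.fromRows Up Xp =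
        Matrix.fromCols T₁ (T₂ * F) * Matrix.fromRows Up Xp := by
      rw [Matrix.fromCols_mul_fromRows, Matrix.fromCols_mul_fromRows, Matrix.mul_assoc T₂, ← hZp,
        ← hT, hZf, hXf, Matrix.mul_add, Matrix.mul_assoc, Matrix.mul_assoc, add_comm]
    have h2 := congrArg (· * R) h1
    simp only [Matrix.mul_assoc, hR, Matrix.mul_one] at h2
    exact Matrix.fromCols_inj h2
  obtain ⟨hFB, hFA⟩ := hFAB
  have hmap : ∀ {p q s : ℕ} (X : Matrix (Fin p) (Fin q) ℝ) (Y : Matrix (Fin q) (Fin s) ℝ),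
      (X * Y).map Complex.ofReal = X.map Complex.ofReal * Y.map Complex.ofReal := by
    intro p q s X Y
    exact Matrix.map_mul (f := Complex.ofRealHom)
  have hXR : ∃ S : Matrix (Fin T) (Fin n) ℝ, Xp * S = 1 := by
    refine ⟨R.toCols₂, ?_⟩
    rw [← Matrix.fromCols_toCols R, Matrix.fromRows_mul_fromCols, ← Matrix.fromBlocks_one] at hR
    exact (Matrix.fromBlocks_inj.1 hR).2.2.2
  obtain ⟨S, hS⟩ := hXR
  have hZS : Zp * (S * G) = 1 := by
    rw [hZp, Matrix.mul_assoc, ← Matrix.mul_assoc Xp, hS, Matrix.one_mul, hG]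
  have hZrank : (Zp.map Complex.ofReal).rank = r := by
    apply le_antisymm
    · simpa using Matrix.rank_le_card_height (Zp.map Complex.ofReal)
    · have h1 : Zp.map Complex.ofReal * (S * G).map Complex.ofReal = 1 := by
        rw [← hmap, hZS]
        exact Matrix.map_one _ Complex.ofReal_zero Complex.ofReal_one
      have h2 := Matrix.rank_mul_le_left (Zp.map Complex.ofReal) ((S * G).map Complex.ofReal)
      rw [h1, Matrix.rank_one] at h2
      simpa using h2
  have hctrl := controllable_of_pbh T₁ T₂ (by
    intro l v h2 h1
    obtain ⟨Q, hQ⟩ := exists_right_inv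
      (l • Zp.map Complex.ofReal - Zf.map Complex.ofReal) (by simpa [hZrank] using hpbh l)
    have hZfc : Zf.map Complex.ofReal = T₁.map Complex.ofReal * Up.map Complex.ofReal
        + T₂.map Complex.ofReal * Zp.map Complex.ofReal := by
      rw [hT, ← hmap, ← hmap]
      ext i j
      simp
    have h3 : v ᵥ* (l • Zp.map Complex.ofReal - Zf.map Complex.ofReal) = 0 := by
      rw [hZfc, Matrix.vecMul_sub, Matrix.vecMul_add, ← Matrix.vecMul_vecMul,
        ← Matrix.vecMul_vecMul, h1, h2, Matrix.vecMul_smul, Matrix.smul_vecMul]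
      simp
    have h4 := congrArg (· ᵥ* Q) h3
    simpa [Matrix.vecMul_vecMul, hQ] using h4)
  obtain ⟨K, hK⟩ := pole_placement T₂.mulVecLin T₁.mulVecLin hctrl p hp (by simpa using hpd)
  refine ⟨LinearMap.toMatrix' K, ?_, ?_⟩
  · rw [← hK, ← Matrix.charpoly_toLin']
    congr 1
    rw [map_add, Matrix.toLin'_mul, Matrix.toLin'_toMatrix', add_comm]
    rfl
  · rw [Matrix.mul_add, Matrix.add_mul, hFA, ← hFB]
    simp only [Matrix.mul_assoc]
    rw [add_comm]
end

section
/- Let A ∈ ℝ^{n×n}, F ∈ ℝ^{r×n} with rank F = r, and let R ∈ ℝ^{d×n}. If rank [FA; RA; F; R] = rank [F; R], then d ≥ rank O(A,F) − r. -/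
open Matrix

/-- The observability matrix `O(A,F) = [F; FA; FA²; …; FA^{n−1}]`,
with rows indexed by `Fin n × Fin r` (block `k` being `F * A^k`). -/
noncomputable def obsMat (n r : ℕ) (A : Matrix (Fin n) (Fin n) ℝ)
    (F : Matrix (Fin r) (Fin n) ℝ) : Matrix (Fin n × Fin r) (Fin n) ℝ :=
  Matrix.of fun p j => (F * A ^ (p.1 : ℕ)) p.2 j

theorem stmt_15 (n r d : ℕ)
    (A : Matrix (Fin n) (Fin n) ℝ)
    (F : Matrix (Fin r) (Fin n) ℝ) (hF : F.rank = r)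
    (R : Matrix (Fin d) (Fin n) ℝ)
    (hrk : (Matrix.fromRows (Matrix.fromRows (F * A) (R * A))
        (Matrix.fromRows F R)).rank = (Matrix.fromRows F R).rank) :
    (obsMat n r A F).rank - r ≤ d := by
  have hle : (Matrix.fromRows F R).rank ≤ r + d := by
    have h := Matrix.rank_le_card_height (Matrix.fromRows F R)
    simpa using h
  rw [Matrix.rank_eq_finrank_span_row, Matrix.rank_eq_finrank_span_row] at hrk
  have hsub : Submodule.span ℝ (Set.range (Matrix.fromRows F R).row) ≤
      Submodule.span ℝ (Set.range (Matrix.fromRows (Matrix.fromRows (F * A) (R * A))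
        (Matrix.fromRows F R)).row) := by
    apply Submodule.span_mono
    rintro _ ⟨i, rfl⟩
    exact ⟨Sum.inr i, rfl⟩
  have heq := Submodule.eq_of_le_of_finrank_eq hsub hrk.symm
  set S := Submodule.span ℝ (Set.range (Matrix.fromRows F R).row) with hS
  have hinv : ∀ v ∈ S, v ᵥ* A ∈ S := by
    have h : S ≤ S.comap A.vecMulLinear := by
      conv_lhs => rw [hS]
      rw [Submodule.span_le]
      rintro _ ⟨i, rfl⟩
      change (Matrix.fromRows F R).row i ᵥ* A ∈ S
      rw [heq]
      apply Submodule.subset_span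
      refine ⟨Sum.inl i, ?_⟩
      rcases i with i | i <;> rfl
    exact h
  have hpow : ∀ (k : ℕ) (i : Fin r), (F * A ^ k).row i ∈ S := by
    intro k
    induction k with
    | zero =>
      intro i
      apply Submodule.subset_span
      refine ⟨Sum.inl i, ?_⟩
      simp only [pow_zero, Matrix.mul_one]
      rfl
    | succ k ih =>
      intro i
      rw [pow_succ, ← Matrix.mul_assoc]
      exact hinv _ (ih i)
  have hobs : (obsMat n r A F).rank ≤ (Matrix.fromRows F R).rank := by
    rw [Matrix.rank_eq_finrank_span_row, Matrix.rank_eq_finrank_span_row]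
    apply Submodule.finrank_mono
    rw [Submodule.span_le]
    rintro _ ⟨p, rfl⟩
    exact hpow p.1 p.2
  omega
end

section
/- Let A ∈ ℝ^{n×n}, F ∈ ℝ^{r×n} with rank F = r, and let R ∈ ℝ^{d×n} satisfy R = P · O(A,F) for some matrix P ∈ ℝ^{d×rn} (i.e., every row of R lies in the row space of the observability matrix) and rank [F; R] = rank O(A,F). Then rank [FA; RA; F; R] = rank [F; R]. -/
open Matrix

lemma row_pow_mem (n r : ℕ) (A : Matrix (Fin n) (Fin n) ℝ)
    (F : Matrix (Fin r) (Fin n) ℝ) (k : ℕ) (i : Fin r) :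
    (F * A ^ k) i ∈ Submodule.span ℝ (Set.range (obsMat n r A F).row) := by
  rcases Nat.eq_zero_or_pos n with h0 | hn
  · subst h0
    rw [Subsingleton.elim ((F * A ^ k) i) 0]
    exact Submodule.zero_mem _
  have hd : (Polynomial.X ^ k %ₘ A.charpoly).natDegree < n := by
    have h1 : A.charpoly.natDegree = n := by simp [Matrix.charpoly_natDegree_eq_dim]
    have := Polynomial.natDegree_modByMonic_lt (Polynomial.X ^ k) A.charpoly_monic
      (by intro h; rw [h] at h1; simp at h1; omega)
    omega
  rw [Matrix.pow_eq_aeval_mod_charpoly, Polynomial.aeval_eq_sum_range' hd, Matrix.mul_sum]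
  have : (∑ j ∈ Finset.range n,
      F * ((Polynomial.X ^ k %ₘ A.charpoly).coeff j • A ^ j)) i =
      ∑ j ∈ Finset.range n, (Polynomial.X ^ k %ₘ A.charpoly).coeff j • (F * A ^ j) i := by
    ext l
    simp [Matrix.sum_apply]
  rw [this]
  refine Submodule.sum_mem _ fun j hj => Submodule.smul_mem _ _ (Submodule.subset_span ?_)
  exact ⟨(⟨j, Finset.mem_range.1 hj⟩, i), rfl⟩

lemma span_vecMul_mem (n r : ℕ) (A : Matrix (Fin n) (Fin n) ℝ)
    (F : Matrix (Fin r) (Fin n) ℝ) (v : Fin n → ℝ)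
    (hv : v ∈ Submodule.span ℝ (Set.range (obsMat n r A F).row)) :
    v ᵥ* A ∈ Submodule.span ℝ (Set.range (obsMat n r A F).row) := by
  induction hv using Submodule.span_induction with
  | mem x hx =>
    obtain ⟨⟨k, i⟩, rfl⟩ := hx
    have h := row_pow_mem n r A F (k + 1) i
    rw [pow_succ, ← Matrix.mul_assoc, Matrix.mul_apply_eq_vecMul] at h
    exact h
  | zero => simp
  | add x y _ _ hx hy => rw [Matrix.add_vecMul]; exact Submodule.add_mem _ hx hy
  | smul c x _ hx => rw [Matrix.smul_vecMul]; exact Submodule.smul_mem _ _ hx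

theorem stmt_16 (n r d : ℕ)
    (A : Matrix (Fin n) (Fin n) ℝ)
    (F : Matrix (Fin r) (Fin n) ℝ) (hF : F.rank = r)
    (R : Matrix (Fin d) (Fin n) ℝ)
    (P : Matrix (Fin d) (Fin n × Fin r) ℝ)
    (hR : R = P * obsMat n r A F)
    (hrk : (Matrix.fromRows F R).rank = (obsMat n r A F).rank) :
    (Matrix.fromRows (Matrix.fromRows (F * A) (R * A))
        (Matrix.fromRows F R)).rank = (Matrix.fromRows F R).rank := by
  have hFm : ∀ i, F i ∈ Submodule.span ℝ (Set.range (obsMat n r A F).row) := fun i => by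
    simpa using row_pow_mem n r A F 0 i
  have hRm : ∀ i, R i ∈ Submodule.span ℝ (Set.range (obsMat n r A F).row) := fun i => by
    have : R i = ∑ p, P i p • (obsMat n r A F).row p := by
      ext l
      simp [hR, Matrix.mul_apply]
    rw [this]
    exact Submodule.sum_mem _ fun p _ =>
      Submodule.smul_mem _ _ (Submodule.subset_span ⟨p, rfl⟩)
  apply le_antisymm
  · rw [hrk, Matrix.rank_eq_finrank_span_row, Matrix.rank_eq_finrank_span_row]
    apply Submodule.finrank_mono
    rw [Submodule.span_le]
    rintro _ ⟨(i | i) | (i | i), rfl⟩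
    · exact span_vecMul_mem n r A F _ (hFm i)
    · exact span_vecMul_mem n r A F _ (hRm i)
    · exact hFm i
    · exact hRm i
  · rw [Matrix.rank_eq_finrank_span_row, Matrix.rank_eq_finrank_span_row]
    apply Submodule.finrank_mono
    apply Submodule.span_mono
    rintro _ ⟨i, rfl⟩
    exact ⟨Sum.inr i, rfl⟩
end

section
/- Let A ∈ ℝ^{n×n}, F ∈ ℝ^{r×n} with rank F = r, and let d_min = rank O(A,F) − r. Then there exists R ∈ ℝ^{d_min×n}, each of whose rows is a row of O(A,F), such that rank [F; R] = rank O(A,F) and rank [FA; RA; F; R] = rank [F; R]. Hence the minimum number of rows of a matrix R satisfying rank [FA; RA; F; R] = rank [F; R] equals rank O(A,F) − r, and the minimum possible order of an augmented target output controller is rank O(A,F). -/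
open Matrix

lemma aux_row_mul {m n : ℕ} {ι : Type*} (M : Matrix ι (Fin m) ℝ) (A : Matrix (Fin m) (Fin n) ℝ) (i : ι) :
    (M * A).row i = Matrix.vecMulLinear A (M.row i) := by
  ext j
  simp [Matrix.mul_apply, Matrix.vecMul, dotProduct]

lemma aux_range_fromRows {n : ℕ} {ι κ : Type*} (M : Matrix ι (Fin n) ℝ) (N : Matrix κ (Fin n) ℝ) :
    Set.range (Matrix.fromRows M N).row = Set.range M.row ∪ Set.range N.row := by
  ext x
  simp only [Set.mem_range, Set.mem_union, Sum.exists]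
  rfl

lemma aux_range_mul {n : ℕ} {ι : Type*} (M : Matrix ι (Fin n) ℝ) (A : Matrix (Fin n) (Fin n) ℝ) :
    Set.range (M * A).row = Matrix.vecMulLinear A '' Set.range M.row := by
  rw [← Set.range_comp]
  congr 1

lemma aux_pow (n : ℕ) (A : Matrix (Fin n) (Fin n) ℝ) :
    A ^ n = - ∑ i ∈ Finset.range n, A.charpoly.coeff i • A ^ i := by
  have h := Matrix.aeval_self_charpoly A
  rw [A.charpoly_monic.as_sum, Matrix.charpoly_natDegree_eq_dim, Fintype.card_fin] at h
  simp only [map_add, map_pow, Polynomial.aeval_X, map_sum, map_mul, Polynomial.aeval_C,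
    ← Algebra.smul_def] at h
  exact eq_neg_of_add_eq_zero_left h

lemma aux_inv (n r : ℕ) (A : Matrix (Fin n) (Fin n) ℝ) (F : Matrix (Fin r) (Fin n) ℝ) :
    Submodule.span ℝ (Matrix.vecMulLinear A '' Set.range (obsMat n r A F).row) ≤
      Submodule.span ℝ (Set.range (obsMat n r A F).row) := by
  rw [Submodule.span_le]
  rintro _ ⟨_, ⟨⟨k, i⟩, rfl⟩, rfl⟩
  have key : ∀ k, k < n → (F * A ^ k).row i ∈ Submodule.span ℝ (Set.range (obsMat n r A F).row) :=
    fun k hk => Submodule.subset_span ⟨(⟨k, hk⟩, i), rfl⟩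
  have e : Matrix.vecMulLinear A ((obsMat n r A F).row (k, i)) = (F * A ^ ((k : ℕ) + 1)).row i := by
    rw [pow_succ, ← Matrix.mul_assoc, aux_row_mul]; rfl
  rw [SetLike.mem_coe, e]
  rcases Nat.lt_or_ge ((k : ℕ) + 1) n with h | h
  · exact key _ h
  · have : (k : ℕ) + 1 = n := by omega
    rw [this, aux_pow]
    have e2 : (F * -∑ j ∈ Finset.range n, A.charpoly.coeff j • A ^ j).row i =
        - ∑ j ∈ Finset.range n, A.charpoly.coeff j • (F * A ^ j).row i := by
      ext l
      simp [Matrix.mul_sum, Matrix.sum_apply]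
    rw [e2]
    exact Submodule.neg_mem _ (Submodule.sum_mem _ fun j hj =>
      Submodule.smul_mem _ _ (key j (Finset.mem_range.1 hj)))

theorem stmt_17 (n r : ℕ)
    (A : Matrix (Fin n) (Fin n) ℝ)
    (F : Matrix (Fin r) (Fin n) ℝ) (hF : F.rank = r) :
    (∃ R : Matrix (Fin ((obsMat n r A F).rank - r)) (Fin n) ℝ,
      (∀ i, ∃ q, ∀ j, R i j = obsMat n r A F q j) ∧
      (Matrix.fromRows F R).rank = (obsMat n r A F).rank ∧
      (Matrix.fromRows (Matrix.fromRows (F * A) (R * A))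
          (Matrix.fromRows F R)).rank = (Matrix.fromRows F R).rank)
    ∧
    (∀ (d : ℕ) (R : Matrix (Fin d) (Fin n) ℝ),
      (Matrix.fromRows (Matrix.fromRows (F * A) (R * A))
          (Matrix.fromRows F R)).rank = (Matrix.fromRows F R).rank →
      (obsMat n r A F).rank - r ≤ d) := by
  have hli : LinearIndependent ℝ F.row := by
    rw [linearIndependent_iff_card_eq_finrank_span, Set.finrank, ← Matrix.rank_eq_finrank_span_row,
      hF, Fintype.card_fin]
  have hrn : r ≤ n := hF ▸ (Matrix.rank_le_width F)
  have hsub : Set.range F.row ⊆ Set.range (obsMat n r A F).row := by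
    rintro _ ⟨i, rfl⟩
    refine ⟨(⟨0, by have := i.2; omega⟩, i), ?_⟩
    ext j
    simp [obsMat]
  have hbig : ∀ (d : ℕ) (R : Matrix (Fin d) (Fin n) ℝ),
      Set.range (Matrix.fromRows (Matrix.fromRows (F * A) (R * A)) (Matrix.fromRows F R)).row =
      Matrix.vecMulLinear A '' Set.range (Matrix.fromRows F R).row ∪
        Set.range (Matrix.fromRows F R).row := by
    intro d R
    rw [aux_range_fromRows, aux_range_fromRows, aux_range_mul, aux_range_mul, ← Set.image_union,
      ← aux_range_fromRows]
  constructor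
  · obtain ⟨b, hbt, hsb, htb, hb⟩ := exists_linearIndepOn_id_extension hli.linearIndepOn_id hsub
    have hspan : Submodule.span ℝ b = Submodule.span ℝ (Set.range (obsMat n r A F).row) :=
      le_antisymm (Submodule.span_mono hbt) (Submodule.span_le.2 htb)
    have hbfin : b.Finite := (Set.finite_range _).subset hbt
    have hbc : b.ncard = (obsMat n r A F).rank := by
      rw [Matrix.rank_eq_finrank_span_row, ← hspan]
      have := hbfin.fintype
      rw [finrank_span_set_eq_card hb, Set.ncard_eq_toFinset_card']
    have hFc : (Set.range F.row).ncard = r := by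
      rw [← Set.image_univ, Set.ncard_image_of_injective _ hli.injective, Set.ncard_univ]
      simp
    have hdc : Nat.card ↥(b \ Set.range F.row) = (obsMat n r A F).rank - r := by
      rw [Nat.card_coe_set_eq, Set.ncard_sdiff hsb (Set.finite_range _), hbc, hFc]
    have : Finite ↥(b \ Set.range F.row) := (hbfin.sdiff).to_subtype
    let e := (Finite.equivFinOfCardEq hdc).symm
    let R : Matrix (Fin ((obsMat n r A F).rank - r)) (Fin n) ℝ := fun i => (e i : Fin n → ℝ)
    have hR : Set.range R.row = b \ Set.range F.row := by
      have : R.row = Subtype.val ∘ e := rfl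
      rw [this, Set.range_comp, e.range_eq_univ, Set.image_univ, Subtype.range_coe]
    have hFR : Set.range (Matrix.fromRows F R).row = b := by
      rw [aux_range_fromRows, hR, Set.union_sdiff_cancel hsb]
    refine ⟨R, ?_, ?_, ?_⟩
    · intro i
      obtain ⟨q, hq⟩ := hbt (e i).2.1
      exact ⟨q, fun j => (congrFun hq j).symm⟩
    · rw [Matrix.rank_eq_finrank_span_row, hFR, hspan, ← Matrix.rank_eq_finrank_span_row]
    · rw [Matrix.rank_eq_finrank_span_row, Matrix.rank_eq_finrank_span_row (Matrix.fromRows F R), hbig, hFR,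
        Submodule.span_union, sup_eq_right.2]
      rw [hspan]
      exact (Submodule.span_mono (Set.image_mono hbt)).trans (aux_inv n r A F)
  · intro d R h
    set W := Submodule.span ℝ (Set.range (Matrix.fromRows F R).row) with hW
    have hinv : ∀ x ∈ W, Matrix.vecMulLinear A x ∈ W := by
      rw [Matrix.rank_eq_finrank_span_row, Matrix.rank_eq_finrank_span_row, hbig,
        Submodule.span_union, ← hW] at h
      have h2 := Submodule.eq_of_le_of_finrank_eq (le_sup_right) h.symm
      intro x hx
      rw [h2]
      apply Submodule.mem_sup_left
      rw [← Submodule.map_span]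
      exact Submodule.mem_map_of_mem hx
    have hk : ∀ (k : ℕ) (i : Fin r), (F * A ^ k).row i ∈ W := by
      intro k i
      induction k with
      | zero => 
        rw [pow_zero, Matrix.mul_one]
        exact Submodule.subset_span ⟨Sum.inl i, rfl⟩
      | succ k ih =>
        rw [pow_succ, ← Matrix.mul_assoc, aux_row_mul]
        exact hinv _ ih
    have hle : Submodule.span ℝ (Set.range (obsMat n r A F).row) ≤ W := by
      rw [Submodule.span_le]
      rintro _ ⟨⟨k, i⟩, rfl⟩
      exact hk k i
    have h3 := Submodule.finrank_mono hle
    rw [hW, ← Matrix.rank_eq_finrank_span_row, ← Matrix.rank_eq_finrank_span_row] at h3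
    have h4 := Matrix.rank_le_card_height (Matrix.fromRows F R)
    simp at h4
    omega
end

section
/- Let A ∈ ℝ^{n×n}, F ∈ ℝ^{r×n}, and let O(A,F) ∈ ℝ^{rn×n} be the observability matrix. Suppose Z ∈ ℝ^{rn×N}, X ∈ ℝ^{n×N}, U ∈ ℝ^{q×N}, and D ∈ ℝ^{rn×q} satisfy Z = O(A,F)·X + D·U, and let Γ ∈ ℝ^{N×N} satisfy UΓ = 0. If XΓ has full row rank n, then rank(ZΓ) = rank O(A,F), and for every M ∈ ℝ^{N×n} with (XΓ)M = I_n one has O(A,F) = ZΓM; i.e., the observability matrix and its rank can be recovered directly from the data. -/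
open Matrix

theorem stmt_18 (n r q N : ℕ)
    (A : Matrix (Fin n) (Fin n) ℝ)
    (F : Matrix (Fin r) (Fin n) ℝ)
    (Z : Matrix (Fin n × Fin r) (Fin N) ℝ)
    (X : Matrix (Fin n) (Fin N) ℝ)
    (U : Matrix (Fin q) (Fin N) ℝ)
    (D : Matrix (Fin n × Fin r) (Fin q) ℝ)
    (hZ : Z = obsMat n r A F * X + D * U)
    (Γ : Matrix (Fin N) (Fin N) ℝ) (hΓ : U * Γ = 0)
    (hXΓ : (X * Γ).rank = n) :
    (Z * Γ).rank = (obsMat n r A F).rank ∧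
    ∀ M : Matrix (Fin N) (Fin n) ℝ, X * Γ * M = 1 →
      obsMat n r A F = Z * Γ * M := by
  have hZG : Z * Γ = obsMat n r A F * (X * Γ) := by
    rw [hZ, Matrix.add_mul, Matrix.mul_assoc, Matrix.mul_assoc, hΓ, Matrix.mul_zero, add_zero]
  have hM : ∀ M : Matrix (Fin N) (Fin n) ℝ, X * Γ * M = 1 →
      obsMat n r A F = Z * Γ * M := by
    intro M h
    rw [hZG, Matrix.mul_assoc, h, Matrix.mul_one]
  refine ⟨le_antisymm ?_ ?_, hM⟩
  · rw [hZG]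
    exact Matrix.rank_mul_le_left _ _
  · have hsurj : Function.Surjective (X * Γ).mulVec := by
      have ht : LinearMap.range (X * Γ).mulVecLin = ⊤ := by
        apply Submodule.eq_top_of_finrank_eq
        rw [Module.finrank_fin_fun]
        exact hXΓ
      exact LinearMap.range_eq_top.mp ht
    obtain ⟨M, h⟩ := Matrix.mulVec_surjective_iff_exists_right_inverse.mp hsurj
    rw [hM M h]
    exact Matrix.rank_mul_le_left _ _
end
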